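/- arXiv:2506.14002 — 2 statements merged into one kernel-verified Lean document; each statement's English description precedes it below -/
import Mathlib

section
/- Concentration for ideal activation. Fix a constant c > 0. There is a constant C > 0, depending only on c, with the following property. Let n ≥ 2, N ≥ 1, s ≥ 1 be integers and ρ ∈ [1/n, 1]. Let E be an N×n matrix with nonnegative entries whose rows e_1,…,e_N satisfy ‖e_l‖₂ = 1 and ‖e_l‖₀ ≤ s, and whose columns satisfy ‖E_{:,i}‖₀ ≤ ρN for every i. Let T be an integer with 1 ≤ T ≤ n^c and let z_{−1}, z_0, …, z_{T−1} be i.i.d. standard Gaussian vectors in ℝ^n. Then for every δ ∈ (exp(−n/4), 1), with probability at least 1 − δ the following holds simultaneously for every integer t with 1 ≤ t ≤ T, every α = (α_{−1},…,α_{t−1}) on the unit sphere of ℝ^{t+1} and every b̄ ∈ ℝ: writing y = Σ_{τ=−1}^{t−1} α_τ z_τ, one has (1/N) Σ_{l=1}^N 1{e_l^⊤ y + b̄ > 0} ≤ C·( Φ(−b̄) + ρ s t log n + ρ s log(1/δ) ). -/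
open MeasureTheory ProbabilityTheory

/-- The standard Gaussian tail function `Φ(x) = ∫_x^∞ (2π)^{-1/2} e^{-u²/2} du`. -/
noncomputable def gaussTail (x : ℝ) : ℝ :=
  ∫ u in Set.Ioi x, Real.exp (-(u ^ 2) / 2) / Real.sqrt (2 * Real.pi)


lemma gaussTail_eq (x : ℝ) : gaussTail x = (gaussianReal 0 1).real (Set.Ioi x) := by
  rw [Measure.real, gaussianReal_apply_eq_integral 0 one_ne_zero, ENNReal.toReal_ofReal]
  · unfold gaussTail gaussianPDFReal
    congr 1
    ext u
    simp [div_eq_inv_mul]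
  · exact integral_nonneg fun u => gaussianPDFReal_nonneg _ _ _

lemma gaussTail_nonneg (x : ℝ) : 0 ≤ gaussTail x := by
  rw [gaussTail_eq]; exact measureReal_nonneg

lemma gaussTail_pos (x : ℝ) : 0 < gaussTail x := by
  rw [gaussTail_eq, measureReal_def]
  refine ENNReal.toReal_pos ?_ (measure_ne_top _ _)
  intro h
  have := gaussianReal_absolutelyContinuous' 0 (v := 1) one_ne_zero h
  simp at this

lemma gaussTail_anti {x y : ℝ} (h : x ≤ y) : gaussTail y ≤ gaussTail x := by
  rw [gaussTail_eq, gaussTail_eq]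
  exact measureReal_mono (Set.Ioi_subset_Ioi h)

lemma gaussTail_lip {x y : ℝ} (h : x ≤ y) : gaussTail x ≤ gaussTail y + (y - x) := by
  have h1 : (gaussianReal 0 1).real (Set.Ioc x y) ≤ y - x := by
    rw [measureReal_def, gaussianReal_apply_eq_integral 0 one_ne_zero, ENNReal.toReal_ofReal]
    · calc ∫ u in Set.Ioc x y, gaussianPDFReal 0 1 u ≤ ∫ u in Set.Ioc x y, (1:ℝ) := by
            apply setIntegral_mono_on (integrable_gaussianPDFReal _ _).integrableOn
              (by simp) measurableSet_Ioc
            intro u _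
            unfold gaussianPDFReal
            have : (1:ℝ) ≤ √(2 * Real.pi * (1:NNReal)) := by
              rw [Real.one_le_sqrt]; simp; nlinarith [Real.pi_gt_three]
            have h2 : (√(2 * Real.pi * (1:NNReal)))⁻¹ ≤ 1 := inv_le_one_of_one_le₀ this
            have h3 : Real.exp (-(u - 0) ^ 2 / (2 * (1:NNReal))) ≤ 1 := by
              rw [Real.exp_le_one_iff]; simp only [sub_zero, NNReal.coe_one, mul_one]; nlinarith [sq_nonneg u]
            exact mul_le_one₀ h2 (Real.exp_nonneg _) h3
        _ = y - x := by simp [h]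
    · exact integral_nonneg fun u => gaussianPDFReal_nonneg _ _ _
  rw [gaussTail_eq, gaussTail_eq, ← Set.Ioc_union_Ioi_eq_Ioi h]
  have := measureReal_union_le (μ := gaussianReal 0 1) (Set.Ioc x y) (Set.Ioi y)
  linarith

lemma gaussian_chernoff (R : ℝ) (hR : 0 ≤ R) :
    (gaussianReal 0 1).real (Set.Ici R) ≤ Real.exp (-(R ^ 2) / 2) := by
  have := measure_ge_le_exp_mul_mgf (μ := gaussianReal 0 1) (X := id) (t := R) R hR
    (by simpa using integrable_exp_mul_gaussianReal (μ := 0) (v := 1) R)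
  rw [mgf_id_gaussianReal, ← Real.exp_add] at this
  refine (le_of_eq ?_).trans (this.trans (le_of_eq ?_))
  · rfl
  · congr 1; simp; ring

lemma gaussTail_le_exp (R : ℝ) (hR : 0 ≤ R) : gaussTail R ≤ Real.exp (-(R ^ 2) / 2) := by
  rw [gaussTail_eq]
  exact (measureReal_mono Set.Ioi_subset_Ici_self).trans (gaussian_chernoff R hR)

lemma gaussian_abs_tail (R : ℝ) (hR : 0 ≤ R) :
    (gaussianReal 0 1).real {x | R < |x|} ≤ 2 * Real.exp (-(R ^ 2) / 2) := by
  have hneg : (gaussianReal 0 1).real (Set.Iic (-R)) = (gaussianReal 0 1).real (Set.Ici R) := by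
    have h := gaussianReal_map_neg (μ := 0) (v := 1)
    rw [neg_zero] at h
    conv_lhs => rw [← h]
    rw [map_measureReal_apply measurable_neg measurableSet_Iic]
    simp
  have hsub : {x : ℝ | R < |x|} ⊆ Set.Iic (-R) ∪ Set.Ici R := by
    intro x hx
    have hx' : R < |x| := hx
    rcases lt_abs.1 hx' with h | h
    · right; exact h.le
    · left; simp; linarith
  have := (measureReal_mono (μ := gaussianReal 0 1) hsub).trans (measureReal_union_le _ _)
  have h2 := gaussian_chernoff R hR
  linarith

section lin
variable {Ω J L : Type*} [MeasurableSpace Ω] [Fintype J] [Fintype L] {P : Measure Ω}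
  {X : J → Ω → ℝ}

lemma lin_gaussian (hX : iIndepFun X P) (hm : ∀ j, Measurable (X j))
    (hlaw : ∀ j, P.map (X j) = gaussianReal 0 1) (a : L → J → ℝ) :
    HasGaussianLaw (fun ω (l : L) => ∑ j, a l j * X j ω) P := by
  classical
  have h1 : ∀ j, HasGaussianLaw (X j) P := fun j => ⟨by rw [hlaw j]; infer_instance⟩
  have h2 := hX.hasGaussianLaw h1
  let A : (J → ℝ) →L[ℝ] (L → ℝ) := LinearMap.toContinuousLinearMap (Matrix.toLin' (Matrix.of a))
  have h3 := h2.map_fun A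
  exact h3

lemma lin_cov (hX : iIndepFun X P) (hm : ∀ j, Measurable (X j))
    (hlaw : ∀ j, P.map (X j) = gaussianReal 0 1) (a b : J → ℝ) :
    cov[fun ω => ∑ j, a j * X j ω, fun ω => ∑ j, b j * X j ω; P] = ∑ j, a j * b j := by
  classical
  have := hX.isProbabilityMeasure
  have h1 : ∀ j, HasGaussianLaw (X j) P := fun j => ⟨by rw [hlaw j]; infer_instance⟩
  have hL : ∀ (a : J → ℝ) j, MemLp (fun ω => a j * X j ω) 2 P := fun a j =>
    ((h1 j).memLp_two).const_mul (a j)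
  rw [covariance_fun_sum_fun_sum (hL a) (hL b)]
  refine Finset.sum_congr rfl fun j _ => ?_
  rw [Finset.sum_eq_single j]
  · rw [covariance_const_mul_left, covariance_const_mul_right, covariance_self (hm j).aemeasurable]
    have : Var[X j; P] = 1 := by
      have h := variance_map (μ := P) (X := id) (Y := X j) aemeasurable_id (hm j).aemeasurable
      rw [hlaw j, variance_id_gaussianReal] at h
      simpa using h.symm
    rw [this]; ring
  · intro k _ hk
    rw [covariance_const_mul_left, covariance_const_mul_right,
      (hX.indepFun hk.symm).covariance_eq_zero (h1 j).memLp_two (h1 k).memLp_two]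
    simp
  · simp

lemma lin_law (hX : iIndepFun X P) (hm : ∀ j, Measurable (X j))
    (hlaw : ∀ j, P.map (X j) = gaussianReal 0 1) (a : J → ℝ) :
    P.map (fun ω => ∑ j, a j * X j ω) = gaussianReal 0 (Real.toNNReal (∑ j, a j ^ 2)) := by
  have := hX.isProbabilityMeasure
  have h1 : ∀ j, HasGaussianLaw (X j) P := fun j => ⟨by rw [hlaw j]; infer_instance⟩
  have h := (lin_gaussian hX hm hlaw (fun _ : Unit => a)).eval ()
  rw [h.map_eq_gaussianReal]
  congr 1
  · rw [integral_finsetSum _ fun j _ => ((h1 j).integrable).const_mul _]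
    refine Finset.sum_eq_zero fun j _ => ?_
    rw [integral_const_mul]
    have : ∫ ω, X j ω ∂P = 0 := by
      have h := integral_map (μ := P) (hm j).aemeasurable (f := fun x : ℝ => x)
        (by fun_prop)
      rw [← h, hlaw j, integral_id_gaussianReal]
    rw [this]; simp
  · rw [← covariance_self, lin_cov hX hm hlaw]
    · simp [pow_two]
    · fun_prop

lemma lin_indep (hX : iIndepFun X P) (hm : ∀ j, Measurable (X j))
    (hlaw : ∀ j, P.map (X j) = gaussianReal 0 1) (a : L → J → ℝ)
    (ha : ∀ l l', l ≠ l' → ∀ j, a l j * a l' j = 0) :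
    iIndepFun (fun (l : L) ω => ∑ j, a l j * X j ω) P := by
  apply (lin_gaussian hX hm hlaw a).iIndepFun_of_covariance_eq_zero
  intro l l' hl
  rw [lin_cov hX hm hlaw]
  exact Finset.sum_eq_zero fun j _ => ha l l' hl j

lemma lin_tail (hX : iIndepFun X P) (hm : ∀ j, Measurable (X j))
    (hlaw : ∀ j, P.map (X j) = gaussianReal 0 1) (a : J → ℝ) (ha : ∑ j, a j ^ 2 ≤ 1)
    (u : ℝ) (hu : 0 ≤ u) :
    P.real {ω | u < ∑ j, a j * X j ω} ≤ gaussTail u := by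
  have hmW : Measurable (fun ω => ∑ j, a j * X j ω) := by fun_prop
  have e1 : P.real {ω | u < ∑ j, a j * X j ω} =
      (P.map (fun ω => ∑ j, a j * X j ω)).real (Set.Ioi u) := by
    rw [map_measureReal_apply hmW measurableSet_Ioi]; rfl
  set v := ∑ j, a j ^ 2
  have hv : 0 ≤ v := Finset.sum_nonneg fun j _ => sq_nonneg _
  have h := gaussianReal_map_const_mul (μ := 0) (v := 1) (√v)
  have e2 : gaussianReal 0 (Real.toNNReal v) = (gaussianReal 0 1).map (√v * ·) := by
    rw [h]; congr 1
    · simp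
    · ext; simp [hv]
  rw [e1, lin_law hX hm hlaw, e2, map_measureReal_apply (by fun_prop) measurableSet_Ioi,
    gaussTail_eq]
  refine measureReal_mono ?_ (measure_ne_top _ _)
  intro x hx
  simp only [Set.mem_preimage, Set.mem_Ioi] at hx ⊢
  have h1 : √v ≤ 1 := by rw [Real.sqrt_le_one]; exact ha
  have h0 := Real.sqrt_nonneg v
  by_contra hcon
  push Not at hcon
  rcases le_total x 0 with hx0 | hx0 <;> nlinarith

end lin

/-- Double counting (Markov) for events. -/
lemma count_markov {Ω : Type*} [MeasurableSpace Ω] (P : Measure Ω) [IsFiniteMeasure P]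
    {L : Type*} [Fintype L] (B : Set Ω) (D : L → Set Ω)
    (hB : MeasurableSet B) (hD : ∀ l, MeasurableSet (D l)) (x : ℝ)
    (h : ∀ ω ∈ B, x ≤ ∑ l, (D l).indicator (fun _ => (1:ℝ)) ω) :
    x * P.real B ≤ ∑ l, P.real (D l) := by
  have h1 : ∫ ω, B.indicator (fun _ => x) ω ∂P ≤
      ∫ ω, ∑ l, (D l).indicator (fun _ => (1:ℝ)) ω ∂P := by
    apply integral_mono
    · exact (integrable_const x).indicator hB
    · exact integrable_finsetSum _ fun l _ => (integrable_const _).indicator (hD l)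
    · intro ω
      by_cases hω : ω ∈ B
      · simpa [hω] using h ω hω
      · simp only [hω, not_false_eq_true, Set.indicator_of_notMem]
        exact Finset.sum_nonneg fun l _ => Set.indicator_nonneg (by simp) _
  rw [integral_indicator_const _ hB, integral_finsetSum _
    fun l _ => (integrable_const _).indicator (hD l)] at h1
  simp only [smul_eq_mul] at h1
  rw [mul_comm]
  refine h1.trans (le_of_eq (Finset.sum_congr rfl fun l _ => ?_))
  rw [integral_indicator_const _ (hD l)]; simp

/-- Tuple-counting tail bound for sums of locally dependent indicators. -/
lemma tuple_bound {Ω : Type*} [MeasurableSpace Ω] (P : Measure Ω) [IsFiniteMeasure P]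
    {L : Type*} [Fintype L] [DecidableEq L] (A : L → Set Ω) (hA : ∀ l, MeasurableSet (A l))
    (conf : L → L → Prop) [DecidableRel conf] (χ p x : ℝ) (hx : 0 < x) (hχ0 : 0 ≤ χ) (hp : 0 ≤ p)
    (hself : ∀ l, conf l l)
    (hχ : ∀ l, ((Finset.univ.filter (fun l' => conf l l')).card : ℝ) ≤ χ)
    (hind : ∀ F : Finset L, (∀ l ∈ F, ∀ l' ∈ F, l ≠ l' → ¬ conf l l') →
      P.real (⋂ l ∈ F, A l) ≤ p ^ F.card)
    (hsymm : ∀ l l', conf l l' → conf l' l) (k : ℕ) :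
    ∀ F : Finset L, (∀ l ∈ F, ∀ l' ∈ F, l ≠ l' → ¬ conf l l') →
    P.real ((⋂ l ∈ F, A l) ∩
      {ω | x + (F.card + k) * χ ≤ ∑ l, (A l).indicator (fun _ => (1:ℝ)) ω}) ≤
      (Fintype.card L * p / x) ^ k * p ^ F.card := by
  classical
  have hmeasX : Measurable (fun ω => ∑ l, (A l).indicator (fun _ => (1:ℝ)) ω) :=
    Finset.measurable_fun_sum _ fun l _ => measurable_const.indicator (hA l)
  induction k with
  | zero =>
    intro F hF
    simp only [pow_zero, one_mul]
    exact (measureReal_mono Set.inter_subset_left).trans (hind F hF)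
  | succ k ih =>
    intro F hF
    set B := (⋂ l ∈ F, A l) ∩
      {ω | x + (F.card + (k + 1 : ℕ)) * χ ≤ ∑ l, (A l).indicator (fun _ => (1:ℝ)) ω} with hBdef
    have hmB : MeasurableSet B :=
      (F.measurableSet_biInter fun l _ => hA l).inter (measurableSet_le measurable_const hmeasX)
    let bad : Finset L := F.biUnion fun l => Finset.univ.filter (fun l' => conf l l')
    have hbad : (bad.card : ℝ) ≤ F.card * χ := by
      calc (bad.card : ℝ) ≤ ((∑ l ∈ F, (Finset.univ.filter (fun l' => conf l l')).card : ℕ) : ℝ) := by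
            exact_mod_cast Finset.card_biUnion_le
        _ ≤ ∑ l ∈ F, χ := by push_cast; exact Finset.sum_le_sum fun l _ => hχ l
        _ = F.card * χ := by simp
    let D : L → Set Ω := fun l => if l ∈ bad then ∅ else A l ∩ B
    have hmD : ∀ l, MeasurableSet (D l) := by
      intro l
      by_cases h : l ∈ bad
      · simp [D, h]
      · simp only [D, h, if_false]; exact (hA l).inter hmB
    have key := count_markov P B D hmB hmD x (by
      intro ω hω
      have h1 : x + (F.card + (k + 1 : ℕ)) * χ ≤ ∑ l, (A l).indicator (fun _ => (1:ℝ)) ω := hω.2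
      have h2 : ∑ l, (A l).indicator (fun _ => (1:ℝ)) ω ≤
          ∑ l, ((D l).indicator (fun _ => (1:ℝ)) ω + if l ∈ bad then (1:ℝ) else 0) := by
        refine Finset.sum_le_sum fun l _ => ?_
        by_cases h : l ∈ bad
        · simp only [D, h, if_true]
          simp [Set.indicator_apply]
          split_ifs <;> norm_num
        · by_cases h' : ω ∈ A l <;> simp [D, h, h', hω]
      rw [Finset.sum_add_distrib] at h2
      have h3 : ∑ l, (if l ∈ bad then (1:ℝ) else 0) = bad.card := by simp
      rw [h3] at h2
      push_cast at h1
      nlinarith [mul_nonneg (Nat.cast_nonneg (α := ℝ) k) hχ0])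
    have hDl : ∀ l, P.real (D l) ≤ (Fintype.card L * p / x) ^ k * p ^ (F.card + 1) := by
      intro l
      by_cases h : l ∈ bad
      · simp only [D, h, if_true]; simp; positivity
      · have hlF : l ∉ F := by
          intro hl
          exact h (Finset.mem_biUnion.2 ⟨l, hl, by simp [hself]⟩)
        have hnc : ∀ l' ∈ F, ¬ conf l' l := by
          intro l' hl' hc
          exact h (Finset.mem_biUnion.2 ⟨l', hl', by simp [hc]⟩)
        have := ih (insert l F) (by
          intro a ha b hb hab
          rw [Finset.mem_insert] at ha hb
          rcases ha with rfl | ha <;> rcases hb with rfl | hb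
          · exact absurd rfl hab
          · exact fun hc => hnc b hb (hsymm _ _ hc)
          · exact hnc a ha
          · exact hF a ha b hb hab)
        rw [Finset.card_insert_of_notMem hlF] at this
        refine le_trans (measureReal_mono ?_) this
        simp only [D, h, if_false]
        rintro ω ⟨hω1, hω2, hω3⟩
        refine ⟨?_, ?_⟩
        · simp only [Finset.mem_insert, Set.mem_iInter] at hω2 ⊢
          rintro a (rfl | ha)
          · exact hω1
          · exact hω2 a ha
        · simp only [Set.mem_ofPred_eq] at hω3 ⊢
          push_cast at hω3 ⊢
          linarith
    have hsum := key.trans (Finset.sum_le_sum fun l (_ : l ∈ Finset.univ) => hDl l)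
    rw [Finset.sum_const, nsmul_eq_mul, Finset.card_univ] at hsum
    have : P.real B ≤ (Fintype.card L * ((Fintype.card L * p / x) ^ k * p ^ (F.card + 1))) / x := by
      rw [le_div_iff₀ hx]; linarith
    refine this.trans (le_of_eq ?_)
    rw [pow_succ (_ / x), pow_succ p]; field_simp

section setup

/-- The product Gaussian measure. -/
noncomputable abbrev gm (T n : ℕ) : Measure (Fin (T + 1) → Fin n → ℝ) :=
  Measure.pi fun _ : Fin (T + 1) => (Measure.pi fun _ : Fin n => gaussianReal 0 1)

/-- The coordinates. -/
def co (T n : ℕ) (q : Fin (T + 1) × Fin n) (z : Fin (T + 1) → Fin n → ℝ) : ℝ := z q.1 q.2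

lemma co_meas (T n : ℕ) (q) : Measurable (co T n q) := by unfold co; fun_prop

lemma co_indep (T n : ℕ) : iIndepFun (co T n) (gm T n) := by
  have h := iIndepFun_uncurry_infinitePi' (ι := Fin (T + 1)) (κ := Fin n)
    (Ω := fun _ _ => ℝ) (X := fun _ _ (x : ℝ) => x) (fun _ _ => gaussianReal 0 1)
    (fun _ _ => measurable_id)
  simp only [Measure.infinitePi_eq_pi] at h
  exact h

lemma co_law (T n : ℕ) (q) : (gm T n).map (co T n q) = gaussianReal 0 1 := by
  have h1 := (measurePreserving_eval (fun _ : Fin (T + 1) =>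
    (Measure.pi fun _ : Fin n => gaussianReal 0 1)) q.1)
  have h2 := (measurePreserving_eval (fun _ : Fin n => gaussianReal 0 1) q.2)
  exact (h2.comp h1).map_eq

/-- The linear statistic. -/
noncomputable def W {T n N : ℕ} (E : Fin N → Fin n → ℝ) (β : Fin (T + 1) → ℝ)
    (l : Fin N) (z : Fin (T + 1) → Fin n → ℝ) : ℝ := ∑ i, E l i * ∑ τ, β τ * z τ i

lemma W_eq {T n N : ℕ} (E : Fin N → Fin n → ℝ) (β : Fin (T + 1) → ℝ)
    (l : Fin N) (z : Fin (T + 1) → Fin n → ℝ) :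
    W E β l z = ∑ q, (E l q.2 * β q.1) * co T n q z := by
  unfold W co
  rw [Fintype.sum_prod_type_right]
  refine Finset.sum_congr rfl fun i _ => ?_
  rw [Finset.mul_sum]
  exact Finset.sum_congr rfl fun τ _ => by ring

lemma conf_card {n N s : ℕ} {ρ : ℝ} (hρ : 0 ≤ ρ) (E : Fin N → Fin n → ℝ)
    (hs : ∀ l, (Function.support (E l)).ncard ≤ s)
    (hcol : ∀ i : Fin n, ((Function.support fun l => E l i).ncard : ℝ) ≤ ρ * N)
    [DecidableRel fun l l' : Fin N => ∃ i, E l i ≠ 0 ∧ E l' i ≠ 0] (l : Fin N) :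
    ((Finset.univ.filter (fun l' => ∃ i, E l i ≠ 0 ∧ E l' i ≠ 0)).card : ℝ) ≤ s * (ρ * N) := by
  classical
  have h1 : (Finset.univ.filter (fun l' => ∃ i, E l i ≠ 0 ∧ E l' i ≠ 0)) ⊆
      (Finset.univ.filter (fun i => E l i ≠ 0)).biUnion
        (fun i => Finset.univ.filter (fun l' => E l' i ≠ 0)) := by
    intro l' h
    simp only [Finset.mem_filter, Finset.mem_univ, true_and, Finset.mem_biUnion] at h ⊢
    exact h
  have hnc : ∀ i : Fin n, ((Finset.univ.filter (fun l' => E l' i ≠ 0)).card : ℝ) ≤ ρ * N := by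
    intro i
    refine le_trans (le_of_eq ?_) (hcol i)
    rw [← Set.ncard_coe_finset]
    congr 2
    ext; simp
  have hnr : (Finset.univ.filter (fun i => E l i ≠ 0)).card ≤ s := by
    refine le_trans (le_of_eq ?_) (hs l)
    rw [← Set.ncard_coe_finset]
    congr 1
    ext; simp
  calc ((Finset.univ.filter (fun l' => ∃ i, E l i ≠ 0 ∧ E l' i ≠ 0)).card : ℝ)
      ≤ ((∑ i ∈ Finset.univ.filter (fun i => E l i ≠ 0),
          (Finset.univ.filter (fun l' => E l' i ≠ 0)).card : ℕ) : ℝ) := by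
        exact_mod_cast (Finset.card_le_card h1).trans Finset.card_biUnion_le
    _ ≤ ∑ i ∈ Finset.univ.filter (fun i => E l i ≠ 0), ρ * N := by
        push_cast; exact Finset.sum_le_sum fun i _ => hnc i
    _ = (Finset.univ.filter (fun i => E l i ≠ 0)).card * (ρ * N) := by simp
    _ ≤ s * (ρ * N) := by gcongr

lemma net_point {T n N s : ℕ} (hN : 1 ≤ N) {ρ : ℝ} (hρ : 0 ≤ ρ) (E : Fin N → Fin n → ℝ)
    (hE : ∀ l, ∑ i, E l i ^ 2 = 1)
    (hs : ∀ l, (Function.support (E l)).ncard ≤ s)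
    (hcol : ∀ i : Fin n, ((Function.support fun l => E l i).ncard : ℝ) ≤ ρ * N)
    (β : Fin (T + 1) → ℝ) (hβ : ∑ τ, β τ ^ 2 ≤ 1) (u : ℝ) (hu : 0 ≤ u) (k : ℕ) :
    (gm T n).real {z | Real.exp 1 * (N * gaussTail u) + k * (s * (ρ * N)) ≤
      ∑ l, {z | u < W E β l z}.indicator (fun _ => (1:ℝ)) z} ≤ Real.exp (-k) := by
  classical
  have hp := gaussTail_pos u
  have hN' : (0:ℝ) < N := by exact_mod_cast hN
  have hmW : ∀ l, Measurable (W E β l) := fun l => by unfold W; fun_prop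
  have hmA : ∀ l, MeasurableSet {z | u < W E β l z} := fun l =>
    measurableSet_lt measurable_const (hmW l)
  have hsq : ∀ l, ∑ q : Fin (T + 1) × Fin n, (E l q.2 * β q.1) ^ 2 ≤ 1 := by
    intro l
    rw [Fintype.sum_prod_type_right]
    simp only [mul_pow, ← Finset.mul_sum, ← Finset.sum_mul]
    rw [hE l, one_mul]; exact hβ
  have htail : ∀ l, (gm T n).real {z | u < W E β l z} ≤ gaussTail u := by
    intro l
    simp only [W_eq]
    exact lin_tail (co_indep T n) (co_meas T n) (co_law T n) _ (hsq l) u hu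
  have key := tuple_bound (gm T n) (fun l => {z | u < W E β l z}) hmA
    (fun l l' => ∃ i, E l i ≠ 0 ∧ E l' i ≠ 0) (s * (ρ * N)) (gaussTail u)
    (Real.exp 1 * (N * gaussTail u)) (by positivity) (by positivity) hp.le
    (by
      intro l
      by_contra hcon
      push Not at hcon
      have h0 : ∀ i, E l i = 0 := fun i => by
        by_contra h; exact h (hcon i h)
      have := hE l
      simp [h0] at this)
    (fun l => conf_card hρ E hs hcol l)
    (by
      intro F hF
      have hind : iIndepFun (fun (l : F) z => W E β (l : Fin N) z) (gm T n) := by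
        simp only [W_eq]
        apply lin_indep (co_indep T n) (co_meas T n) (co_law T n)
          (fun (l : F) (q : Fin (T + 1) × Fin n) => E l q.2 * β q.1)
        intro l l' hl q
        have := hF l l.2 l' l'.2 (fun h => hl (Subtype.ext h))
        push Not at this
        by_cases h : E l q.2 = 0
        · simp [h]
        · simp [this q.2 h]
      have h1 := hind.measure_inter_preimage_eq_mul Finset.univ
        (sets := fun _ => Set.Ioi u) (fun _ _ => measurableSet_Ioi)
      have h2 : (⋂ l ∈ F, {z | u < W E β l z}) =
          ⋂ l ∈ (Finset.univ : Finset F), (fun z => W E β (l : Fin N) z) ⁻¹' (Set.Ioi u) := by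
        ext z; simp
      rw [h2, measureReal_def, h1, ENNReal.toReal_prod]
      calc _ ≤ ∏ l : F, gaussTail u := by
            apply Finset.prod_le_prod
            · intro _ _; positivity
            · intro l _; exact htail l
        _ = _ := by simp)
    (by rintro l l' ⟨i, h, h'⟩; exact ⟨i, h', h⟩) k ∅ (by simp)
  simp only [Finset.notMem_empty, Set.iInter_of_empty, Set.iInter_univ, Set.univ_inter,
    Finset.card_empty, Nat.cast_zero, zero_add, pow_zero, mul_one, Fintype.card_fin] at key
  refine key.trans (le_of_eq ?_)
  have : (N * gaussTail u) / (Real.exp 1 * (N * gaussTail u)) = Real.exp (-1) := by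
    rw [Real.exp_neg]; field_simp
  rw [this, ← Real.exp_nat_mul]; congr 1; ring

lemma round_toward (M : ℕ) (hM : 0 < M) (x : ℝ) (hx : |x| ≤ 1) :
    ∃ k : ℤ, k ∈ Finset.Icc (-(M:ℤ)) M ∧ ((k:ℝ) / M) ^ 2 ≤ x ^ 2 ∧ |x - k / M| ≤ 1 / M := by
  have hM' : (0:ℝ) < M := by exact_mod_cast hM
  have pos : ∀ x : ℝ, 0 ≤ x → x ≤ 1 → ∃ k : ℤ, 0 ≤ k ∧ k ≤ M ∧ (k:ℝ) / M ≤ x ∧ x - k / M ≤ 1 / M := by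
    intro x h0 h1
    refine ⟨⌊x * M⌋, Int.floor_nonneg.2 (by positivity), ?_, ?_, ?_⟩
    · have : ((⌊x * M⌋ : ℤ) : ℝ) ≤ M := (Int.floor_le _).trans (by nlinarith)
      exact_mod_cast this
    · rw [div_le_iff₀ hM']; exact Int.floor_le _
    · rw [sub_le_iff_le_add, ← add_div, le_div_iff₀ hM']
      have := Int.lt_floor_add_one (x * M)
      linarith
  obtain ⟨hx1, hx2⟩ := abs_le.1 hx
  rcases le_total 0 x with h | h
  · obtain ⟨k, h1, h2, h3, h4⟩ := pos x h hx2
    refine ⟨k, by rw [Finset.mem_Icc]; omega, ?_, ?_⟩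
    · have : (0:ℝ) ≤ k / M := div_nonneg (by exact_mod_cast h1) hM'.le
      nlinarith
    · rw [abs_of_nonneg (by linarith)]; exact h4
  · obtain ⟨k, h1, h2, h3, h4⟩ := pos (-x) (by linarith) (by linarith)
    refine ⟨-k, by rw [Finset.mem_Icc]; omega, ?_, ?_⟩
    · have : (0:ℝ) ≤ k / M := div_nonneg (by exact_mod_cast h1) hM'.le
      push_cast
      rw [neg_div, neg_sq]
      nlinarith
    · push_cast
      rw [neg_div, abs_of_nonpos (by linarith)]; linarith

/-- Extension by zero. -/
noncomputable def ext0 (T : ℕ) {t : ℕ} (a : Fin (t + 1) → ℝ) (τ : Fin (T + 1)) : ℝ :=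
  if h : τ.val < t + 1 then a ⟨τ.val, h⟩ else 0

lemma ext0_sum {T t : ℕ} (htT : t ≤ T) (a : Fin (t + 1) → ℝ) (f : Fin (T + 1) → ℝ → ℝ)
    (hf : ∀ τ, f τ 0 = 0) :
    ∑ τ, f τ (ext0 T a τ) = ∑ τ : Fin (t + 1), f (Fin.castLE (Nat.succ_le_succ htT) τ) (a τ) := by
  symm
  apply Fintype.sum_of_injective (Fin.castLE (Nat.succ_le_succ htT))
    (Fin.castLE_injective _)
  · intro τ hτ
    have : ¬ τ.val < t + 1 := by
      intro h
      exact hτ ⟨⟨τ.val, h⟩, by ext; simp⟩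
    simp [ext0, this, hf]
  · intro τ
    have : τ.val ≤ t := Nat.lt_succ_iff.1 τ.2
    simp [ext0, this]

end setup

/-- The grid of rounded coefficient vectors. -/
noncomputable def net (T n t : ℕ) : Finset (Fin (t + 1) → ℤ) := by
  classical
  exact (Fintype.piFinset fun _ => Finset.Icc (-((4 * n ^ 4 : ℕ):ℤ)) ((4 * n ^ 4 : ℕ):ℤ)).filter
    fun g => ∑ τ, (ext0 T (fun τ => (g τ : ℝ) / (4 * n ^ 4 : ℕ)) τ) ^ 2 ≤ 1

/-- Moment order. -/
noncomputable def ord (n t : ℕ) (δ : ℝ) : ℕ := ⌈21 * t * Real.log n + Real.log δ⁻¹⌉₊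

/-- Bad event at a net point. -/
def badPt {T n N : ℕ} (s : ℕ) (ρ δ : ℝ) (E : Fin N → Fin n → ℝ) (t : ℕ)
    (g : Fin (t + 1) → ℤ) (j : ℕ) : Set (Fin (T + 1) → Fin n → ℝ) :=
  {z | Real.exp 1 * (N * gaussTail ((j:ℝ) / n)) + ord n t δ * (s * (ρ * N)) ≤
      ∑ l, {z | (j:ℝ) / n < W E (ext0 T (fun τ => (g τ : ℝ) / (4 * n ^ 4 : ℕ))) l z}.indicator
        (fun _ => (1:ℝ)) z}

/-- Bad event for the size of the coordinates. -/
def badSize (T n : ℕ) : Set (Fin (T + 1) → Fin n → ℝ) :=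
  ⋃ q ∈ (Finset.univ.filter fun q : Fin (T + 1) × Fin n => q.1.val < n),
    {z | 4 * (n:ℝ) < |co T n q z|}

lemma badSize_le (T n : ℕ) (hn : 2 ≤ n) (δ : ℝ) (hδ : Real.exp (-(n : ℝ) / 4) < δ) :
    (gm T n).real (badSize T n) ≤ δ / 2 := by
  have hn' : (2:ℝ) ≤ n := by exact_mod_cast hn
  have hcard : (Finset.univ.filter fun q : Fin (T + 1) × Fin n => q.1.val < n).card ≤ n * n := by
    have : (Finset.univ.filter fun q : Fin (T + 1) × Fin n => q.1.val < n).card ≤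
        (Finset.range n ×ˢ (Finset.univ : Finset (Fin n))).card := by
      apply Finset.card_le_card_of_injOn (fun q => (q.1.val, q.2))
      · intro q hq
        simpa using hq
      · rintro ⟨a, b⟩ _ ⟨c, d⟩ _ h
        simp only [Prod.mk.injEq] at h ⊢
        exact ⟨Fin.ext h.1, h.2⟩
    simpa using this
  have h1 : (gm T n).real (badSize T n) ≤
      ∑ q ∈ (Finset.univ.filter fun q : Fin (T + 1) × Fin n => q.1.val < n),
        (2 * Real.exp (-((4 * (n:ℝ)) ^ 2) / 2)) := by
    refine (measureReal_biUnion_finset_le _ _).trans (Finset.sum_le_sum fun q _ => ?_)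
    have := gaussian_abs_tail (4 * n) (by positivity)
    rw [← co_law T n q, map_measureReal_apply (co_meas T n q)
      (measurableSet_lt measurable_const (by fun_prop))] at this
    exact this
  rw [Finset.sum_const, nsmul_eq_mul] at h1
  have h2 : (((Finset.univ.filter fun q : Fin (T + 1) × Fin n => q.1.val < n).card : ℕ) : ℝ) ≤
      (n:ℝ) * n := by exact_mod_cast hcard
  have h3 : 4 * ((n:ℝ) * n) * Real.exp (-((4 * (n:ℝ)) ^ 2) / 2) ≤ Real.exp (-(n : ℝ) / 4) := by
    have e : Real.exp (-((4 * (n:ℝ)) ^ 2) / 2) =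
        Real.exp (-(n : ℝ) / 4) * Real.exp (-(8 * n ^ 2 - n / 4)) := by
      rw [← Real.exp_add]; congr 1; ring
    have h4 : 4 * ((n:ℝ) * n) ≤ Real.exp (8 * n ^ 2 - n / 4) := by
      have := Real.add_one_le_exp (8 * (n:ℝ) ^ 2 - n / 4)
      nlinarith
    rw [e, Real.exp_neg (8 * (n:ℝ) ^ 2 - n / 4)]
    have hpos := Real.exp_pos (8 * (n:ℝ) ^ 2 - n / 4)
    have h5 : 4 * ((n:ℝ) * n) * (Real.exp (8 * (n:ℝ) ^ 2 - n / 4))⁻¹ ≤ 1 := by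
      rw [← div_eq_mul_inv, div_le_one hpos]; exact h4
    have := Real.exp_pos (-(n : ℝ) / 4)
    nlinarith
  have h6 := Real.exp_pos (-((4 * (n:ℝ)) ^ 2) / 2)
  nlinarith

lemma net_card (T n t : ℕ) (hn : 2 ≤ n) : (net T n t).card ≤ n ^ (8 * (t + 1)) := by
  classical
  unfold net
  refine (Finset.card_filter_le _ _).trans ?_
  rw [Fintype.card_piFinset]
  simp only [Int.card_Icc, Finset.prod_const, Finset.card_univ, Fintype.card_fin]
  rw [pow_mul]
  apply Nat.pow_le_pow_left
  have e : (((4 * n ^ 4 : ℕ):ℤ) + 1 - -((4 * n ^ 4 : ℕ):ℤ)).toNat = 8 * n ^ 4 + 1 := by omega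
  rw [e]
  have h4 : 16 ≤ n ^ 4 := by
    calc 16 = 2 ^ 4 := by norm_num
      _ ≤ n ^ 4 := Nat.pow_le_pow_left hn 4
  have : n ^ 8 = n ^ 4 * n ^ 4 := by ring
  nlinarith

lemma badPts_le {T n N s : ℕ} (hn : 2 ≤ n) (hN : 1 ≤ N) {ρ : ℝ} (hρ : 0 ≤ ρ)
    (E : Fin N → Fin n → ℝ) (hE : ∀ l, ∑ i, E l i ^ 2 = 1)
    (hs : ∀ l, (Function.support (E l)).ncard ≤ s)
    (hcol : ∀ i : Fin n, ((Function.support fun l => E l i).ncard : ℝ) ≤ ρ * N)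
    (δ : ℝ) (hδ : 0 < δ) :
    (gm T n).real (⋃ t ∈ Finset.Ico 1 n, ⋃ g ∈ net T n t, ⋃ j ∈ Finset.range (n ^ 2 + 1),
      badPt s ρ δ E t g j) ≤ δ / 2 := by
  have hn' : (2:ℝ) ≤ n := by exact_mod_cast hn
  have hn0 : (0:ℝ) < n := by linarith
  have hpt : ∀ t g j, g ∈ net T n t →
      (gm T n).real (badPt s ρ δ E t g j) ≤ δ / (n:ℝ) ^ (21 * t) := by
    intro t g j hg
    unfold net at hg
    rw [Finset.mem_filter] at hg
    refine (net_point hN hρ E hE hs hcol _ hg.2 _ (by positivity) _).trans ?_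
    have h1 : 21 * t * Real.log n + Real.log δ⁻¹ ≤ ord n t δ := Nat.le_ceil _
    calc Real.exp (-(ord n t δ : ℝ)) ≤ Real.exp (Real.log (δ / (n:ℝ) ^ (21 * t))) := by
          apply Real.exp_le_exp.2
          rw [Real.log_div hδ.ne' (by positivity), Real.log_pow]
          rw [Real.log_inv] at h1
          push_cast
          linarith
      _ = _ := Real.exp_log (by positivity)
  have hper : ∀ t ∈ Finset.Ico 1 n, (gm T n).real (⋃ g ∈ net T n t,
      ⋃ j ∈ Finset.range (n ^ 2 + 1), badPt s ρ δ E t g j) ≤ δ / (2 * n) := by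
    intro t ht
    rw [Finset.mem_Ico] at ht
    calc _ ≤ ∑ g ∈ net T n t, ∑ j ∈ Finset.range (n ^ 2 + 1), δ / (n:ℝ) ^ (21 * t) := by
          refine (measureReal_biUnion_finset_le _ _).trans (Finset.sum_le_sum fun g hg => ?_)
          exact (measureReal_biUnion_finset_le _ _).trans
            (Finset.sum_le_sum fun j _ => hpt t g j hg)
      _ = (((net T n t).card * (n ^ 2 + 1) : ℕ) : ℝ) * (δ / (n:ℝ) ^ (21 * t)) := by
          simp; ring
      _ ≤ ((n ^ (19 * t) : ℕ) : ℝ) * (δ / (n:ℝ) ^ (21 * t)) := by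
          have : (net T n t).card * (n ^ 2 + 1) ≤ n ^ (19 * t) := by
            calc (net T n t).card * (n ^ 2 + 1) ≤ n ^ (8 * (t + 1)) * n ^ 3 := by
                  apply Nat.mul_le_mul (net_card T n t hn)
                  nlinarith [Nat.mul_le_mul hn hn, pow_pos (by omega : 0 < n) 2, Nat.mul_le_mul hn (le_refl (n^2))]
              _ = n ^ (8 * (t + 1) + 3) := by rw [pow_add]
              _ ≤ n ^ (19 * t) := Nat.pow_le_pow_right (by omega) (by omega)
          gcongr
      _ = δ / (n:ℝ) ^ (2 * t) := by
          have e : (n:ℝ) ^ (21 * t) = (n:ℝ) ^ (19 * t) * (n:ℝ) ^ (2 * t) := by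
            rw [← pow_add]; congr 1; ring
          rw [e]; push_cast; field_simp
      _ ≤ δ / (2 * n) := by
          apply div_le_div_of_nonneg_left hδ.le (by positivity)
          calc 2 * (n:ℝ) ≤ (n:ℝ) ^ 2 := by nlinarith
            _ ≤ (n:ℝ) ^ (2 * t) := pow_le_pow_right₀ (by linarith) (by omega)
  calc _ ≤ ∑ t ∈ Finset.Ico 1 n, δ / (2 * n) :=
        (measureReal_biUnion_finset_le _ _).trans (Finset.sum_le_sum hper)
    _ = ((n - 1 : ℕ) : ℝ) * (δ / (2 * n)) := by simp
    _ ≤ n * (δ / (2 * n)) := by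
        gcongr; omega
    _ = δ / 2 := by field_simp

lemma perturb {T n N t : ℕ} (hn : 2 ≤ n) (htT : t ≤ T) (htn : t < n)
    (E : Fin N → Fin n → ℝ) (hE : ∀ l, ∑ i, E l i ^ 2 = 1)
    (a b : Fin (t + 1) → ℝ) (hab : ∀ τ, |a τ - b τ| ≤ 1 / (4 * n ^ 4 : ℕ))
    (z : Fin (T + 1) → Fin n → ℝ) (hz : z ∉ badSize T n) (l : Fin N) :
    W E (ext0 T a) l z ≤ W E (ext0 T b) l z + 1 / n := by
  have hn' : (2:ℝ) ≤ n := by exact_mod_cast hn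
  have hzq : ∀ τ i, τ.val < n → |z τ i| ≤ 4 * n := by
    intro τ i h
    by_contra hcon
    push Not at hcon
    apply hz
    unfold badSize
    simp only [Set.mem_iUnion]
    exact ⟨(τ, i), by simp [h], hcon⟩
  have hE1 : ∀ i, |E l i| ≤ 1 := by
    intro i
    rw [← sq_le_one_iff_abs_le_one, ← hE l]
    exact Finset.single_le_sum (f := fun i => E l i ^ 2) (fun i _ => sq_nonneg _) (Finset.mem_univ i)
  have hS : ∀ i (a : Fin (t + 1) → ℝ), ∑ τ, ext0 T a τ * z τ i =
      ∑ τ : Fin (t + 1), a τ * z (Fin.castLE (Nat.succ_le_succ htT) τ) i := fun i a =>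
    ext0_sum htT a (fun τ x => x * z τ i) (by simp)
  have hdiff : W E (ext0 T a) l z - W E (ext0 T b) l z =
      ∑ i, E l i * ∑ τ : Fin (t + 1), (a τ - b τ) * z (Fin.castLE (Nat.succ_le_succ htT) τ) i := by
    unfold W
    rw [← Finset.sum_sub_distrib]
    refine Finset.sum_congr rfl fun i _ => ?_
    rw [← mul_sub, hS, hS, ← Finset.sum_sub_distrib]
    congr 1
    exact Finset.sum_congr rfl fun τ _ => by ring
  have hb : W E (ext0 T a) l z - W E (ext0 T b) l z ≤ 1 / n := by
    rw [hdiff]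
    calc _ ≤ ∑ i : Fin n, ∑ τ : Fin (t + 1), (1 / ((4 * n ^ 4 : ℕ):ℝ)) * (4 * n) := by
          refine Finset.sum_le_sum fun i _ => ?_
          refine (le_abs_self _).trans ?_
          rw [abs_mul]
          refine (mul_le_of_le_one_left (abs_nonneg _) (hE1 i)).trans ?_
          refine (Finset.abs_sum_le_sum_abs _ _).trans (Finset.sum_le_sum fun τ _ => ?_)
          rw [abs_mul]
          have hτ : (Fin.castLE (Nat.succ_le_succ htT) τ).val < n := by
            simp only [Fin.val_castLE]; omega
          exact mul_le_mul (hab τ) (hzq _ i hτ) (abs_nonneg _) (by positivity)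
      _ = (n:ℝ) * ((t + 1 : ℕ) * ((1 / ((4 * n ^ 4 : ℕ):ℝ)) * (4 * n))) := by simp
      _ ≤ (n:ℝ) * (n * ((1 / ((4 * n ^ 4 : ℕ):ℝ)) * (4 * n))) := by
          gcongr; omega
      _ = 1 / n := by push_cast; field_simp
  linarith

lemma choose_j (n : ℕ) (hn : 2 ≤ n) (u : ℝ) (hu : 1 < u) :
    ∃ j ∈ Finset.range (n ^ 2 + 1), (j:ℝ) / n ≤ u - 1 / n ∧
      gaussTail ((j:ℝ) / n) ≤ gaussTail u + 2 / n := by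
  have hn' : (2:ℝ) ≤ n := by exact_mod_cast hn
  have hn0 : (0:ℝ) < n := by linarith
  have hpos : 0 ≤ n * u - 1 := by nlinarith
  by_cases h : ⌊n * u - 1⌋₊ ≤ n ^ 2
  · refine ⟨⌊n * u - 1⌋₊, by rw [Finset.mem_range]; omega, ?_, ?_⟩
    · rw [div_le_iff₀ hn0, sub_mul, one_div_mul_cancel hn0.ne']
      have := Nat.floor_le hpos
      linarith
    · have h1 := Nat.lt_floor_add_one (n * u - 1)
      have h0 := Nat.floor_le hpos
      have hle : (⌊n * u - 1⌋₊ : ℝ) / n ≤ u := by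
        rw [div_le_iff₀ hn0]; linarith
      refine (gaussTail_lip hle).trans ?_
      have : u - (⌊n * u - 1⌋₊ : ℝ) / n ≤ 2 / n := by
        rw [sub_le_iff_le_add, ← add_div, le_div_iff₀ hn0]; linarith
      linarith
  · push Not at h
    have h2 : ((n ^ 2 : ℕ) : ℝ) ≤ n * u - 1 := by
      have h3 : ((n ^ 2 : ℕ) : ℝ) ≤ ⌊n * u - 1⌋₊ := by exact_mod_cast h.le
      exact h3.trans (Nat.floor_le hpos)
    refine ⟨n ^ 2, by simp, ?_, ?_⟩
    · rw [div_le_iff₀ hn0, sub_mul, one_div_mul_cancel hn0.ne']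
      linarith
    · have e : ((n ^ 2 : ℕ) : ℝ) / n = n := by push_cast; field_simp
      rw [e]
      have h4 := gaussTail_le_exp n hn0.le
      have h5 : Real.exp (-((n:ℝ) ^ 2) / 2) ≤ 2 / n := by
        rw [neg_div, Real.exp_neg, inv_le_comm₀ (Real.exp_pos _) (by positivity), inv_div]
        have := Real.add_one_le_exp ((n:ℝ) ^ 2 / 2)
        nlinarith
      have := gaussTail_nonneg u
      linarith

set_option maxHeartbeats 4000000 in
theorem ideal_activation_concentration (c : ℝ) (hc : 0 < c) :
    ∃ C : ℝ, 0 < C ∧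
      ∀ (n N s : ℕ), 2 ≤ n → 1 ≤ N → 1 ≤ s →
      ∀ ρ : ℝ, (n : ℝ)⁻¹ ≤ ρ → ρ ≤ 1 →
      ∀ E : Fin N → Fin n → ℝ,
        (∀ l i, 0 ≤ E l i) →
        (∀ l, Real.sqrt (∑ i, E l i ^ 2) = 1) →
        (∀ l, (Function.support (E l)).ncard ≤ s) →
        (∀ i : Fin n, ((Function.support fun l => E l i).ncard : ℝ) ≤ ρ * N) →
      ∀ T : ℕ, 1 ≤ T → (T : ℝ) ≤ (n : ℝ) ^ c →
      ∀ δ : ℝ, Real.exp (-(n : ℝ) / 4) < δ → δ < 1 →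
        ENNReal.ofReal (1 - δ) ≤
          (Measure.pi fun _ : Fin (T + 1) =>
              (Measure.pi fun _ : Fin n => gaussianReal 0 1))
            {z | ∀ t : ℕ, 1 ≤ t → ∀ htT : t ≤ T,
              ∀ α : Fin (t + 1) → ℝ, (∑ τ, α τ ^ 2) = 1 → ∀ bbar : ℝ,
                (1 / (N : ℝ)) *
                    (∑ l, if 0 < (∑ i, E l i *
                          ∑ τ : Fin (t + 1), α τ * z (Fin.castLE (Nat.succ_le_succ htT) τ) i)
                          + bbar then (1 : ℝ) else 0) ≤
                  C * (gaussTail (-bbar) + ρ * s * t * Real.log n +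
                    ρ * s * Real.log δ⁻¹)} := by
  have hG1 := gaussTail_pos 1
  refine ⟨35 + 1 / gaussTail 1, by positivity, ?_⟩
  intro n N s hn hN hs1 ρ hρn _ E _ hEs hsp hcol T _ _ δ hδ hδ1
  have hn' : (2:ℝ) ≤ n := by exact_mod_cast hn
  have hn0 : (0:ℝ) < n := by linarith
  have hN' : (0:ℝ) < N := by exact_mod_cast hN
  have hs' : (1:ℝ) ≤ s := by exact_mod_cast hs1
  have hρ0 : 0 < ρ := lt_of_lt_of_le (by positivity) hρn
  have hδ0 : 0 < δ := (Real.exp_pos _).trans hδ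
  have hE : ∀ l, ∑ i, E l i ^ 2 = 1 := fun l => by
    have := hEs l
    rwa [Real.sqrt_eq_one] at this
  have hlogδ : 0 ≤ Real.log δ⁻¹ := by
    rw [Real.log_inv]; have := Real.log_nonpos hδ0.le hδ1.le; linarith
  have hlogn : 1 / 2 ≤ Real.log n := by
    have h1 := Real.log_le_log (by norm_num) hn'
    have h2 := Real.log_two_gt_d9
    linarith
  set PT : Set (Fin (T + 1) → Fin n → ℝ) :=
    ⋃ t ∈ Finset.Ico 1 n, ⋃ g ∈ net T n t, ⋃ j ∈ Finset.range (n ^ 2 + 1),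
      badPt s ρ δ E t g j with hPT
  have hbad : (gm T n) (badSize T n ∪ PT) ≤ ENNReal.ofReal δ := by
    rw [← ofReal_measureReal]
    apply ENNReal.ofReal_le_ofReal
    have h1 := badSize_le T n hn δ hδ
    have h2 := badPts_le (T := T) hn hN hρ0.le E hE hsp hcol δ hδ0
    have h3 := measureReal_union_le (μ := gm T n) (badSize T n) PT
    linarith
  set good : Set (Fin (T + 1) → Fin n → ℝ) := {z | ∀ t : ℕ, 1 ≤ t → ∀ htT : t ≤ T,
              ∀ α : Fin (t + 1) → ℝ, (∑ τ, α τ ^ 2) = 1 → ∀ bbar : ℝ,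
                (1 / (N : ℝ)) *
                    (∑ l, if 0 < (∑ i, E l i *
                          ∑ τ : Fin (t + 1), α τ * z (Fin.castLE (Nat.succ_le_succ htT) τ) i)
                          + bbar then (1 : ℝ) else 0) ≤
                  (35 + 1 / gaussTail 1) * (gaussTail (-bbar) + ρ * s * t * Real.log n +
                    ρ * s * Real.log δ⁻¹)} with hgood
  suffices hsub : Set.univ ⊆ good ∪ (badSize T n ∪ PT) by
    have h1 : (1 : ENNReal) ≤ gm T n good + ENNReal.ofReal δ := by
      calc (1 : ENNReal) = gm T n Set.univ := measure_univ.symm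
        _ ≤ gm T n good + gm T n (badSize T n ∪ PT) :=
          (measure_mono hsub).trans (measure_union_le _ _)
        _ ≤ _ := by gcongr
    rw [ENNReal.ofReal_sub _ hδ0.le, ENNReal.ofReal_one]
    exact tsub_le_iff_right.2 h1
  intro z _
  by_cases hzS : z ∈ badSize T n
  · exact Or.inr (Or.inl hzS)
  by_cases hzP : z ∈ PT
  · exact Or.inr (Or.inr hzP)
  left
  intro t ht1 htT α hα bbar
  have ht' : (1:ℝ) ≤ t := by exact_mod_cast ht1
  have hρs : (n:ℝ)⁻¹ ≤ ρ * s := hρn.trans (by nlinarith)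
  have hG := gaussTail_nonneg (-bbar)
  have hρs0 : 0 ≤ ρ * s := by positivity
  have hA : 0 ≤ ρ * s * t * Real.log n := by positivity
  have hB : 0 ≤ ρ * s * Real.log δ⁻¹ := by positivity
  have hA1 : (n:ℝ)⁻¹ * t * (1 / 2) ≤ ρ * s * t * Real.log n := by gcongr
  have hL1 : (1 / (N : ℝ)) * (∑ l, if 0 < (∑ i, E l i *
      ∑ τ : Fin (t + 1), α τ * z (Fin.castLE (Nat.succ_le_succ htT) τ) i)
      + bbar then (1 : ℝ) else 0) ≤ 1 := by
    rw [one_div, inv_mul_le_iff₀ hN', mul_one]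
    calc _ ≤ ∑ l : Fin N, (1:ℝ) := by
          refine Finset.sum_le_sum fun l _ => ?_
          split_ifs <;> norm_num
      _ = N := by simp
  have hG1' : 0 ≤ 1 / gaussTail 1 := by positivity
  have hQ0 : 0 ≤ gaussTail (-bbar) + ρ * s * t * Real.log n + ρ * s * Real.log δ⁻¹ := by positivity
  -- trivial case: many steps
  by_cases htn : n ≤ t
  · refine hL1.trans ?_
    have h1 : (n:ℝ) ≤ t := by exact_mod_cast htn
    have h2 : 1 / 2 ≤ ρ * s * t * Real.log n := by
      refine le_trans ?_ hA1
      have : 1 ≤ (n:ℝ)⁻¹ * t := by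
        rw [inv_mul_eq_div, le_div_iff₀ hn0]; linarith
      linarith
    nlinarith [mul_nonneg hG1' hQ0]
  push Not at htn
  -- trivial case: small threshold
  by_cases hu : -bbar ≤ 1
  · refine hL1.trans ?_
    have h1 := gaussTail_anti hu
    have h2 : 1 ≤ 1 / gaussTail 1 * gaussTail (-bbar) := by
      rw [one_div_mul_eq_div, le_div_iff₀ hG1]; linarith
    nlinarith [mul_nonneg hG1' hA, mul_nonneg hG1' hB]
  push Not at hu
  obtain ⟨j, hj, hj1, hj2⟩ := choose_j n hn (-bbar) hu
  have hα1 : ∀ τ, |α τ| ≤ 1 := by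
    intro τ
    rw [← sq_le_one_iff_abs_le_one, ← hα]
    exact Finset.single_le_sum (f := fun τ => α τ ^ 2) (fun i _ => sq_nonneg _)
      (Finset.mem_univ τ)
  choose g hg1 hg2 hg3 using fun τ => round_toward (4 * n ^ 4) (by positivity) (α τ) (hα1 τ)
  have hgnet : g ∈ net T n t := by
    unfold net
    rw [Finset.mem_filter]
    refine ⟨Fintype.mem_piFinset.2 hg1, ?_⟩
    rw [ext0_sum htT _ (fun _ x => x ^ 2) (by simp), ← hα]
    exact Finset.sum_le_sum fun τ _ => hg2 τ
  have hnot : z ∉ badPt s ρ δ E t g j := by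
    intro hz
    apply hzP
    rw [hPT]
    simp only [Set.mem_iUnion]
    exact ⟨t, Finset.mem_Ico.2 ⟨ht1, htn⟩, g, hgnet, j, hj, hz⟩
  have hcount : ∑ l, {z | (j:ℝ) / n <
      W E (ext0 T (fun τ => (g τ : ℝ) / (4 * n ^ 4 : ℕ))) l z}.indicator (fun _ => (1:ℝ)) z <
      Real.exp 1 * (N * gaussTail ((j:ℝ) / n)) + ord n t δ * (s * (ρ * N)) := by
    by_contra hcon
    push Not at hcon
    exact hnot hcon
  have hcmp : (∑ l, if 0 < (∑ i, E l i *
      ∑ τ : Fin (t + 1), α τ * z (Fin.castLE (Nat.succ_le_succ htT) τ) i)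
      + bbar then (1 : ℝ) else 0) ≤ ∑ l, {z | (j:ℝ) / n <
      W E (ext0 T (fun τ => (g τ : ℝ) / (4 * n ^ 4 : ℕ))) l z}.indicator (fun _ => (1:ℝ)) z := by
    refine Finset.sum_le_sum fun l _ => ?_
    have hW : (∑ i, E l i *
        ∑ τ : Fin (t + 1), α τ * z (Fin.castLE (Nat.succ_le_succ htT) τ) i) =
        W E (ext0 T α) l z := by
      unfold W
      refine Finset.sum_congr rfl fun i _ => ?_
      rw [ext0_sum htT α (fun τ x => x * z τ i) (by simp)]
    rw [hW]
    split_ifs with h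
    · have hp := perturb hn htT htn E hE α _ hg3 z hzS l
      rw [Set.indicator_of_mem]
      show (j:ℝ) / n < W E (ext0 T (fun τ => (g τ : ℝ) / (4 * n ^ 4 : ℕ))) l z
      linarith
    · exact Set.indicator_nonneg (by simp) _
  have hord : (ord n t δ : ℝ) ≤ 23 * t * Real.log n + Real.log δ⁻¹ := by
    have h1 : (ord n t δ : ℝ) < 21 * t * Real.log n + Real.log δ⁻¹ + 1 :=
      Nat.ceil_lt_add_one (by positivity)
    have h2 : (1:ℝ) * (1 / 2) ≤ t * Real.log n := by gcongr
    nlinarith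
  have he : Real.exp 1 ≤ 3 := by have := Real.exp_one_lt_d9; linarith
  have hninv : 1 / (n:ℝ) ≤ 2 * (ρ * s * t * Real.log n) := by
    have : (n:ℝ)⁻¹ * 1 * (1 / 2) ≤ ρ * s * t * Real.log n := by
      refine le_trans ?_ hA1; gcongr
    rw [one_div]; linarith
  have hfin : (1 / (N : ℝ)) * (∑ l, if 0 < (∑ i, E l i *
      ∑ τ : Fin (t + 1), α τ * z (Fin.castLE (Nat.succ_le_succ htT) τ) i)
      + bbar then (1 : ℝ) else 0) ≤
      Real.exp 1 * gaussTail ((j:ℝ) / n) + ord n t δ * (s * ρ) := by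
    rw [one_div, inv_mul_le_iff₀ hN']
    refine (hcmp.trans hcount.le).trans (le_of_eq ?_)
    ring
  have h1 : Real.exp 1 * gaussTail ((j:ℝ) / n) ≤ 3 * (gaussTail (-bbar) + 2 / n) := by
    apply mul_le_mul he hj2 (gaussTail_nonneg _) (by norm_num)
  have h2 : (ord n t δ : ℝ) * (s * ρ) ≤ (23 * t * Real.log n + Real.log δ⁻¹) * (s * ρ) := by
    gcongr
  have h3 : (2:ℝ) / n = 2 * (1 / n) := by ring
  rw [h3] at h1
  nlinarith [mul_nonneg hG1' hQ0]
end

section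
/- Monotonicity and convexity of a reparametrized Gaussian tail. Fix q > 1 and b̄ < 0, and define f : [0,1] → ℝ by f(x) = Φ( −b̄ / √( ((q−1)/q)·x + 1/q ) ), where Φ is the standard Gaussian tail function. Then f is strictly increasing on [0,1]; and if moreover b̄ ≤ −√3, then f is convex on [0,1]. -/
open MeasureTheory

lemma gaussDens_integrable :
    Integrable (fun u : ℝ => Real.exp (-(u ^ 2) / 2) / Real.sqrt (2 * Real.pi)) := by
  have h := (integrable_exp_neg_mul_sq (b := 1 / 2) (by norm_num)).div_const
    (Real.sqrt (2 * Real.pi))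
  refine h.congr (Filter.Eventually.of_forall fun u => ?_)
  simp only
  congr 2
  ring

lemma gaussTail_hasDerivAt (x : ℝ) :
    HasDerivAt gaussTail (-(Real.exp (-(x ^ 2) / 2) / Real.sqrt (2 * Real.pi))) x := by
  have hI := gaussDens_integrable
  have hc : Continuous (fun u : ℝ => Real.exp (-(u ^ 2) / 2) / Real.sqrt (2 * Real.pi)) := by
    fun_prop
  have h1 : gaussTail = fun y => gaussTail 0 -
      ∫ u in (0 : ℝ)..y, Real.exp (-(u ^ 2) / 2) / Real.sqrt (2 * Real.pi) := by
    funext y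
    have h := intervalIntegral.integral_interval_add_Ioi' (a := 0) (b := y)
      (μ := volume) (f := fun u : ℝ => Real.exp (-(u ^ 2) / 2) / Real.sqrt (2 * Real.pi))
      (hc.intervalIntegrable _ _) hI.integrableOn
    unfold gaussTail
    linarith
  rw [h1]
  exact (hc.integral_hasStrictDerivAt 0 x).hasDerivAt.const_sub _

lemma gaussTail_strictAnti : StrictAnti gaussTail := by
  apply strictAnti_of_deriv_neg
  intro x
  rw [(gaussTail_hasDerivAt x).deriv]
  have := Real.pi_pos
  have : 0 < Real.exp (-(x ^ 2) / 2) / Real.sqrt (2 * Real.pi) := by positivity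
  linarith

lemma comp_hasDerivAt (c t : ℝ) (ht : 0 < t) :
    HasDerivAt (fun t => gaussTail (c / Real.sqrt t))
      (c / 2 / Real.sqrt (2 * Real.pi) *
        ((1 / Real.sqrt t) ^ 3 * Real.exp (-(c ^ 2 * (1 / t)) / 2))) t := by
  have hs : 0 < Real.sqrt t := Real.sqrt_pos.2 ht
  have h1 := ((Real.hasDerivAt_sqrt ht.ne').inv hs.ne').const_mul c
  have h2 := (gaussTail_hasDerivAt (c * (Real.sqrt t)⁻¹)).comp t h1
  have hp : 0 < Real.sqrt (2 * Real.pi) := by have := Real.pi_pos; positivity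
  have he : (c * (Real.sqrt t)⁻¹) ^ 2 = c ^ 2 * (1 / t) := by
    rw [mul_pow, inv_pow, Real.sq_sqrt ht.le, one_div]
  rw [he] at h2
  refine (h2.congr_deriv ?_)
  field_simp

lemma key_mono (c a t : ℝ) (hc : 3 ≤ c ^ 2) (ha : 0 < a) (hat : a ≤ t) (ht : t ≤ 1) :
    (1 / Real.sqrt a) ^ 3 * Real.exp (-(c ^ 2 * (1 / a)) / 2) ≤
    (1 / Real.sqrt t) ^ 3 * Real.exp (-(c ^ 2 * (1 / t)) / 2) := by
  have ht0 : 0 < t := ha.trans_le hat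
  have hsa : 0 < Real.sqrt a := Real.sqrt_pos.2 ha
  have hst : 0 < Real.sqrt t := Real.sqrt_pos.2 ht0
  have sq : ∀ z : ℝ, 0 < z → ((1 / Real.sqrt z) ^ 3 * Real.exp (-(c ^ 2 * (1 / z)) / 2)) ^ 2
      = (1 / z) ^ 3 * Real.exp (-(c ^ 2 * (1 / z))) := by
    intro z hz
    rw [mul_pow, ← pow_mul, ← Real.exp_nat_mul, mul_comm 3 2, pow_mul, div_pow, Real.sq_sqrt hz.le]
    congr 2 <;> push_cast <;> ring
  refine (sq_le_sq₀ (by positivity) (by positivity)).1 ?_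
  rw [sq a ha, sq t ht0]
  have h1 : t / a ≤ Real.exp (t / a - 1) := by
    have := Real.add_one_le_exp (t / a - 1); linarith
  have h2 : (t / a) ^ 3 ≤ Real.exp (3 * (t / a - 1)) := by
    have := pow_le_pow_left₀ (by positivity) h1 3
    rwa [← Real.exp_nat_mul] at this
  have h3 : 3 * (t / a - 1) ≤ c ^ 2 * (1 / a) - c ^ 2 * (1 / t) := by
    have e1 : c ^ 2 * (1 / a) - c ^ 2 * (1 / t) = c ^ 2 / t * (t / a - 1) := by
      field_simp
    rw [e1]
    have : 1 ≤ t / a := (one_le_div ha).2 hat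
    apply mul_le_mul_of_nonneg_right _ (by linarith)
    rw [le_div_iff₀ ht0]; nlinarith
  have h4 := h2.trans (Real.exp_le_exp.2 h3)
  have e2 : (1 / a) ^ 3 = (1 / t) ^ 3 * (t / a) ^ 3 := by field_simp
  have e3 : Real.exp (-(c ^ 2 * (1 / t))) =
      Real.exp (c ^ 2 * (1 / a) - c ^ 2 * (1 / t)) * Real.exp (-(c ^ 2 * (1 / a))) := by
    rw [← Real.exp_add]; congr 1; ring
  rw [e2, e3, mul_assoc]
  gcongr

lemma comp_convex (c : ℝ) (hc0 : 0 < c) (hc : 3 ≤ c ^ 2) :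
    ConvexOn ℝ (Set.Ioc 0 1) (fun t => gaussTail (c / Real.sqrt t)) := by
  apply MonotoneOn.convexOn_of_deriv (convex_Ioc 0 1)
  · intro t ht
    exact (comp_hasDerivAt c t ht.1).continuousAt.continuousWithinAt
  · intro t ht
    rw [interior_Ioc] at ht
    exact (comp_hasDerivAt c t ht.1).differentiableAt.differentiableWithinAt
  · rw [interior_Ioc]
    intro a ha t ht hat
    rw [(comp_hasDerivAt c a ha.1).deriv, (comp_hasDerivAt c t ht.1).deriv]
    exact mul_le_mul_of_nonneg_left (key_mono c a t hc ha.1 hat ht.2.le) (by positivity)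

/-- Monotonicity and convexity of the reparametrized Gaussian tail
`f(x) = Φ(-b̄/√(((q-1)/q)x + 1/q))` on `[0,1]`, for `q > 1` and `b̄ < 0`:
`f` is strictly increasing on `[0,1]`, and if moreover `b̄ ≤ -√3` then `f` is convex
on `[0,1]`. -/
theorem gaussTail_reparam_strictMono_convex (q b : ℝ) (hq : 1 < q) (hb : b < 0) :
    StrictMonoOn (fun x : ℝ => gaussTail (-b / Real.sqrt ((q - 1) / q * x + 1 / q)))
        (Set.Icc 0 1) ∧
      (b ≤ -Real.sqrt 3 →
        ConvexOn ℝ (Set.Icc 0 1)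
          (fun x : ℝ => gaussTail (-b / Real.sqrt ((q - 1) / q * x + 1 / q)))) := by
  have hq0 : 0 < q := by linarith
  have hα : 0 < (q - 1) / q := div_pos (by linarith) hq0
  have hβ : 0 < 1 / q := by positivity
  have hsum : (q - 1) / q + 1 / q = 1 := by field_simp; ring
  constructor
  · intro x hx y hy hxy
    have h0 : 0 < (q - 1) / q * x + 1 / q := by
      have := mul_nonneg hα.le hx.1; linarith
    have h1 : (q - 1) / q * x + 1 / q < (q - 1) / q * y + 1 / q := by
      have := mul_lt_mul_of_pos_left hxy hα; linarith
    apply gaussTail_strictAnti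
    exact div_lt_div_of_pos_left (by linarith) (Real.sqrt_pos.2 h0)
      (Real.sqrt_lt_sqrt h0.le h1)
  · intro hb3
    have hc : 3 ≤ (-b) ^ 2 := by
      have h3 : Real.sqrt 3 ≤ -b := by linarith
      have := pow_le_pow_left₀ (Real.sqrt_nonneg 3) h3 2
      rwa [Real.sq_sqrt (by norm_num)] at this
    have hC := comp_convex (-b) (by linarith) hc
    have hm : ∀ x ∈ Set.Icc (0 : ℝ) 1, (q - 1) / q * x + 1 / q ∈ Set.Ioc (0 : ℝ) 1 := by
      intro x hx
      have h1 := mul_nonneg hα.le hx.1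
      have h2 := mul_le_mul_of_nonneg_left hx.2 hα.le
      exact ⟨by linarith, by linarith⟩
    refine ⟨convex_Icc 0 1, ?_⟩
    intro x hx y hy u v hu hv huv
    have h := hC.2 (hm x hx) (hm y hy) hu hv huv
    simp only [smul_eq_mul] at h ⊢
    have e : (q - 1) / q * (u * x + v * y) + 1 / q =
        u * ((q - 1) / q * x + 1 / q) + v * ((q - 1) / q * y + 1 / q) := by
      linear_combination (-(1 / q)) * huv
    rw [e]
    exact h
end
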